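/- The map Φ from the space of continuous (n₁,…,nₘ)-symmetric (n₁+⋯+nₘ)-linear maps T : E₁^{n₁}×⋯×Eₘ^{nₘ} → F to the space of continuous (n₁,…,nₘ)-homogeneous polynomials E₁×⋯×Eₘ → F, defined by Φ(T) = T̂, is a linear bijection, and for every (n₁,…,nₘ)-symmetric T one has ‖T̂‖ ≤ ‖T‖ ≤ (n₁^{n₁}⋯nₘ^{nₘ}/(n₁!⋯nₘ!)) ‖T̂‖; in particular Φ is an isomorphism of Banach spaces. -/

import Mathlib

open scoped BigOperators

/-- `P` is a continuous `(n₁,…,nₘ)`-homogeneous polynomial (multipolynomial): for each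
coordinate `i` and each choice of the other variables, the map `y ↦ P (x with i-th entry y)`
is a continuous `n i`-homogeneous polynomial on `E i`. -/
def IsMultipolynomial (𝕜 : Type*) [RCLike 𝕜] {m : ℕ} (n : Fin m → ℕ)
    {E : Fin m → Type*} [∀ i, NormedAddCommGroup (E i)] [∀ i, NormedSpace 𝕜 (E i)]
    {F : Type*} [NormedAddCommGroup F] [NormedSpace 𝕜 F]
    (P : ((i : Fin m) → E i) → F) : Prop :=
  ∀ (i : Fin m) (x : (j : Fin m) → E j),
    ∃ A : ContinuousMultilinearMap 𝕜 (fun _ : Fin (n i) => E i) F,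
      ∀ y : E i, P (Function.update x i y) = A (fun _ => y)

/-- A continuous `(n₁ + ⋯ + nₘ)`-linear map `T : E₁^{n₁} × ⋯ × Eₘ^{nₘ} → F` is
`(n₁,…,nₘ)`-symmetric if it is invariant under permuting, within each block `i`,
the `n i` variables from `E i`. -/
def BlockSymmetric {𝕜 : Type*} [RCLike 𝕜] {m : ℕ} {n : Fin m → ℕ}
    {E : Fin m → Type*} [∀ i, NormedAddCommGroup (E i)] [∀ i, NormedSpace 𝕜 (E i)]
    {F : Type*} [NormedAddCommGroup F] [NormedSpace 𝕜 F]
    (T : ContinuousMultilinearMap 𝕜 (fun p : Σ i : Fin m, Fin (n i) => E p.1) F) : Prop :=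
  ∀ (σ : (i : Fin m) → Equiv.Perm (Fin (n i)))
    (x : (p : Σ i : Fin m, Fin (n i)) → E p.1),
    T (fun p => x ⟨p.1, σ p.1 p.2⟩) = T x

/-- The norm of a multipolynomial: `‖P‖ = sup {‖P x‖ : ‖xᵢ‖ ≤ 1, i = 1,…,m}`. -/
noncomputable def polyNorm {m : ℕ} {E : Fin m → Type*} [∀ i, NormedAddCommGroup (E i)]
    {F : Type*} [NormedAddCommGroup F]
    (P : ((i : Fin m) → E i) → F) : ℝ :=
  sSup {r : ℝ | ∃ x : (i : Fin m) → E i, (∀ i, ‖x i‖ ≤ 1) ∧ r = ‖P x‖}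

section SignedSum

variable {ι : Type*} [Fintype ι] [DecidableEq ι]
  {κ : ι → Type*} [∀ i, Fintype (κ i)] [∀ i, DecidableEq (κ i)]

/-- The orthogonality relation for products of signs. -/
theorem sum_signs_mul_prod_apply (r : ∀ i, κ i → κ i) :
    ∑ ε : ∀ i, κ i → ℤˣ, (((∏ i, ∏ k, ε i k) * ∏ i, ∏ k, ε i (r i k) : ℤˣ) : ℤ) =
      if ∀ i, Function.Bijective (r i) then (Fintype.card (∀ i, κ i → ℤˣ) : ℤ) else 0 := by
  split_ifs with h
  · have key (ε : ∀ i, κ i → ℤˣ) :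
        (∏ i, ∏ k, ε i k) * ∏ i, ∏ k, ε i (r i k) = 1 := by
      have : ∏ i, ∏ k, ε i (r i k) = ∏ i, ∏ k, ε i k :=
        Finset.prod_congr rfl fun i _ => (h i).prod_comp (ε i)
      rw [this, Int.units_mul_self]
    simp [key]
  · push Not at h
    obtain ⟨i, hi⟩ := h
    have hs : ¬ Function.Surjective (r i) := fun hs => hi (Finite.surjective_iff_bijective.1 hs)
    simp only [Function.Surjective, not_forall, not_exists] at hs
    obtain ⟨k, hk⟩ := hs
    set δ : ∀ i, κ i → ℤˣ := Pi.mulSingle i (Pi.mulSingle k (-1)) with hδ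
    have h1 : ∏ j, ∏ l, δ j l = -1 := by
      rw [Finset.prod_eq_single i]
      · simp [hδ]
      · intro j _ hj
        simp [hδ, Pi.mulSingle_eq_of_ne hj]
      · simp
    have h2 : ∏ j, ∏ l, δ j (r j l) = 1 := by
      refine Finset.prod_eq_one fun j _ => Finset.prod_eq_one fun l _ => ?_
      rcases eq_or_ne j i with rfl | hj
      · simp [hδ, Pi.mulSingle_eq_of_ne (hk l)]
      · simp [hδ, Pi.mulSingle_eq_of_ne hj]
    have hneg := Fintype.sum_equiv (Equiv.mulRight δ)
      (fun ε => (((∏ i, ∏ k, (ε * δ) i k) * ∏ i, ∏ k, (ε * δ) i (r i k) : ℤˣ) : ℤ))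
      (fun ε => (((∏ i, ∏ k, ε i k) * ∏ i, ∏ k, ε i (r i k) : ℤˣ) : ℤ)) fun ε => rfl
    simp only [Pi.mul_apply, Finset.prod_mul_distrib, h1, h2] at hneg
    simp only [mul_neg, mul_one, neg_mul, Units.val_neg, Finset.sum_neg_distrib] at hneg
    omega

variable {𝕜 : Type*} [Field 𝕜] {E : ι → Type*} [∀ i, AddCommGroup (E i)] [∀ i, Module 𝕜 (E i)]
  {F : Type*} [AddCommGroup F] [Module 𝕜 F]

variable (𝕜) in
/-- The sum, over all choices of signs, of the signed values of `P` at the signed block sums. -/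
def signedSum (P : (∀ i, E i) → F) (x : ∀ p : Σ i, κ i, E p.1) : F :=
  ∑ ε : ∀ i, κ i → ℤˣ, (((∏ i, ∏ k, ε i k : ℤˣ) : ℤ) : 𝕜) •
    P fun i => ∑ k, ((ε i k : ℤ) : 𝕜) • x ⟨i, k⟩

/-- The polarization formula for block-multilinear maps. -/
theorem signedSum_diagonal (T : MultilinearMap 𝕜 (fun p : Σ i, κ i => E p.1) F)
    (x : ∀ p : Σ i, κ i, E p.1) :
    signedSum 𝕜 (fun y => T fun p => y p.1) x = (Fintype.card (∀ i, κ i → ℤˣ) : 𝕜) •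
      ∑ σ : ∀ i, Equiv.Perm (κ i), T fun p => x ⟨p.1, σ p.1 p.2⟩ := by
  have expand (ε : ∀ i, κ i → ℤˣ) :
      T (fun p => ∑ k, ((ε p.1 k : ℤ) : 𝕜) • x ⟨p.1, k⟩) =
        ∑ r : ∀ i, κ i → κ i, (((∏ i, ∏ k, ε i (r i k) : ℤˣ) : ℤ) : 𝕜) •
          T fun p => x ⟨p.1, r p.1 p.2⟩ := by
    rw [T.map_sum (fun (p : Σ i, κ i) (k : κ p.1) => ((ε p.1 k : ℤ) : 𝕜) • x ⟨p.1, k⟩)]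
    refine Fintype.sum_equiv (Equiv.piCurry fun i _ => κ i) _ _ fun r => ?_
    rw [T.map_smul_univ (fun p => ((ε p.1 (r p) : ℤ) : 𝕜)) fun p => x ⟨p.1, r p⟩]
    simp [Fintype.prod_sigma, Sigma.curry]
  simp only [signedSum, expand, Finset.smul_sum, smul_smul]
  rw [Finset.sum_comm]
  have hsum (r : ∀ i, κ i → κ i) :
      ∑ ε : ∀ i, κ i → ℤˣ, ((((∏ i, ∏ k, ε i k : ℤˣ) : ℤ) : 𝕜) *
        (((∏ i, ∏ k, ε i (r i k) : ℤˣ) : ℤ) : 𝕜)) • T (fun p => x ⟨p.1, r p.1 p.2⟩) =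
      if ∀ i, Function.Bijective (r i) then
        (Fintype.card (∀ i, κ i → ℤˣ) : 𝕜) • T (fun p => x ⟨p.1, r p.1 p.2⟩) else 0 := by
    rw [← Finset.sum_smul]
    have := congrArg (Int.cast : ℤ → 𝕜) (sum_signs_mul_prod_apply r)
    simp only [Int.cast_sum, Units.val_mul, Int.cast_mul] at this
    rw [this]
    split_ifs <;> simp
  rw [Finset.sum_congr rfl fun r _ => hsum r]
  symm
  refine Finset.sum_of_injOn (fun σ i => ⇑(σ i)) ?_
    (fun _ _ => Finset.mem_coe.2 (Finset.mem_univ _)) ?_ ?_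
  · intro σ _ τ _ h
    funext i
    exact DFunLike.coe_injective (congrFun h i)
  · intro r _ hr
    exact if_neg fun h => hr
      ⟨fun i => Equiv.ofBijective _ (h i), Finset.mem_coe.2 (Finset.mem_univ _), rfl⟩
  · intro σ _
    exact (if_pos fun i => (σ i).bijective).symm

theorem card_signs_smul_signedSum (P : (∀ i, E i) → F) (x : ∀ p : Σ i, κ i, E p.1) (i : ι) :
    (Fintype.card (κ i → ℤˣ) : 𝕜) • signedSum 𝕜 P x =
      ∑ ε : ∀ i, κ i → ℤˣ, (((∏ i, ∏ k, ε i k : ℤˣ) : ℤ) : 𝕜) •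
        ∑ δ : κ i → ℤˣ, (((∏ k, δ k : ℤˣ) : ℤ) : 𝕜) •
          P (Function.update (fun j => ∑ k, ((ε j k : ℤ) : 𝕜) • x ⟨j, k⟩) i
            (∑ k, ((δ k : ℤ) : 𝕜) • ((ε i k : ℤ) : 𝕜) • x ⟨i, k⟩)) := by
  have shift (δ : κ i → ℤˣ) : signedSum 𝕜 P x =
      ∑ ε : ∀ i, κ i → ℤˣ, (((∏ i, ∏ k, ε i k : ℤˣ) : ℤ) : 𝕜) •
        (((∏ k, δ k : ℤˣ) : ℤ) : 𝕜) •
          P (Function.update (fun j => ∑ k, ((ε j k : ℤ) : 𝕜) • x ⟨j, k⟩) i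
            (∑ k, ((δ k : ℤ) : 𝕜) • ((ε i k : ℤ) : 𝕜) • x ⟨i, k⟩)) := by
    rw [signedSum]
    symm
    refine Fintype.sum_equiv (Equiv.mulRight (Pi.mulSingle i δ)) _ _ fun ε => ?_
    have hprod : ∏ j, ∏ k, (Pi.mulSingle i δ : ∀ i, κ i → ℤˣ) j k = ∏ k, δ k := by
      rw [Finset.prod_eq_single i]
      · simp
      · intro j _ hj
        simp [Pi.mulSingle_eq_of_ne hj]
      · simp
    simp only [Equiv.coe_mulRight, Pi.mul_apply, Finset.prod_mul_distrib, hprod, Units.val_mul,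
      Int.cast_mul, smul_smul]
    congr 2
    funext j
    rcases eq_or_ne j i with rfl | hj
    · simp [mul_comm]
    · simp [hj]
  simp only [Finset.smul_sum]
  rw [Finset.sum_comm]
  simp only [← shift, Finset.sum_const, Finset.card_univ, Nat.cast_smul_eq_nsmul]

theorem signedSum_comp_perm (P : (∀ i, E i) → F) (σ : ∀ i, Equiv.Perm (κ i))
    (x : ∀ p : Σ i, κ i, E p.1) :
    signedSum 𝕜 P (fun p => x ⟨p.1, σ p.1 p.2⟩) = signedSum 𝕜 P x := by
  refine Fintype.sum_equiv
    (Equiv.piCongrRight fun i => (σ i).arrowCongr (Equiv.refl ℤˣ)) _ _ fun ε => ?_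
  have hprod (i : ι) : ∏ k, ε i ((σ i).symm k) = ∏ k, ε i k := (σ i).symm.prod_comp _
  have hsum (i : ι) : ∑ k, ((ε i ((σ i).symm k) : ℤ) : 𝕜) • x ⟨i, k⟩ =
      ∑ k, ((ε i k : ℤ) : 𝕜) • x ⟨i, σ i k⟩ := by
    rw [← Equiv.sum_comp (σ i)]
    simp
  simp [hprod, hsum]

/-- The signed sum of a homogeneous map on a block diagonal. -/
theorem signedSum_diagonal_of_homogeneous {P : (∀ i, E i) → F}
    (hP : ∀ (c : ι → 𝕜) (x : ∀ i, E i),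
      P (fun i => c i • x i) = (∏ i, c i ^ Fintype.card (κ i)) • P x) (x : ∀ i, E i) :
    signedSum 𝕜 P (fun p : Σ i, κ i => x p.1) =
      ((Fintype.card (∀ i, κ i → ℤˣ) : 𝕜) * ∏ i, ((Fintype.card (κ i)).factorial : 𝕜)) • P x := by
  have hpow (f : ι → 𝕜) : ∏ p : Σ i, κ i, f p.1 = ∏ i, f i ^ Fintype.card (κ i) := by
    simp [Fintype.prod_sigma]
  have hpol := signedSum_diagonal (𝕜 := 𝕜) (κ := κ) (E := fun _ : ι => 𝕜) (F := 𝕜)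
    (MultilinearMap.mkPiAlgebra 𝕜 (Σ i, κ i) 𝕜) fun _ => 1
  have h : ∑ ε : ∀ i, κ i → ℤˣ, (((∏ i, ∏ k, ε i k : ℤˣ) : ℤ) : 𝕜) *
      ∏ p : Σ i, κ i, ∑ k, ((ε p.1 k : ℤ) : 𝕜) * 1 = (Fintype.card (∀ i, κ i → ℤˣ) : 𝕜) *
        ∑ _σ : ∀ i, Equiv.Perm (κ i), ∏ _p : Σ i, κ i, (1 : 𝕜) := hpol
  simp only [fun ε : ∀ i, κ i → ℤˣ => hpow fun i => ∑ k, ((ε i k : ℤ) : 𝕜) * 1] at h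
  simp only [signedSum, ← Finset.sum_smul, hP, smul_smul]
  congr 1
  simpa [Fintype.card_perm] using h

end SignedSum

section SeparateContinuity

variable {𝕜 : Type*} [RCLike 𝕜] {ι : Type*} [Fintype ι]
  {G : ι → Type*} [∀ i, NormedAddCommGroup (G i)] [∀ i, NormedSpace 𝕜 (G i)]
  {F : Type*} [NormedAddCommGroup F] [NormedSpace 𝕜 F]

theorem MultilinearMap.norm_le_mul_prod_of_norm_le_on_unit_ball (M : MultilinearMap 𝕜 G F) {C : ℝ}
    (h : ∀ x : ∀ i, G i, (∀ i, ‖x i‖ ≤ 1) → ‖M x‖ ≤ C) (x : ∀ i, G i) :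
    ‖M x‖ ≤ C * ∏ i, ‖x i‖ := by
  have hx : M x = (∏ i, ((‖x i‖ : ℝ) : 𝕜)) • M fun i => ((‖x i‖⁻¹ : ℝ) : 𝕜) • x i := by
    rw [← M.map_smul_univ]
    congr 1
    funext i
    rcases eq_or_ne (x i) 0 with h0 | h0
    · simp [h0]
    · rw [smul_smul, ← RCLike.ofReal_mul, mul_inv_cancel₀ (norm_ne_zero_iff.2 h0)]
      simp
  rw [hx, norm_smul, mul_comm, norm_prod]
  simp only [RCLike.norm_ofReal, abs_norm]
  refine mul_le_mul_of_nonneg_right (h _ fun i => ?_) (Finset.prod_nonneg fun i _ => norm_nonneg _)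
  rw [norm_smul, RCLike.norm_ofReal, abs_of_nonneg (inv_nonneg.2 (norm_nonneg _))]
  exact inv_mul_le_one

/-- A separately continuous multilinear map on a product of Banach spaces is bounded. -/
theorem MultilinearMap.exists_bound_of_separately_continuous [DecidableEq ι]
    [∀ i, CompleteSpace (G i)] (M : MultilinearMap 𝕜 G F)
    (hM : ∀ (x : ∀ i, G i) (i : ι), Continuous fun y => M (Function.update x i y)) :
    ∃ C : ℝ, ∀ x, ‖M x‖ ≤ C * ∏ i, ‖x i‖ := by
  have key (s : Finset ι) : ∀ x : ∀ i, G i, ∃ C : ℝ, ∀ y : ∀ i, G i,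
      (∀ i ∈ s, ‖y i‖ ≤ 1) → (∀ i ∉ s, y i = x i) → ‖M y‖ ≤ C := by
    induction s using Finset.induction_on with
    | empty =>
      intro x
      exact ⟨‖M x‖, fun y _ hy => by rw [funext fun i => hy i (Finset.notMem_empty i)]⟩
    | insert i s his ih =>
      intro x
      let I := {y : ∀ j, G j // (∀ j ∈ s, ‖y j‖ ≤ 1) ∧ ∀ j ∉ insert i s, y j = x j}
      let g : I → G i →L[𝕜] F := fun y => ⟨M.toLinearMap y.1 i, hM y.1 i⟩
      have hg (y : I) (z : G i) : g y z = M (Function.update y.1 i z) := rfl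
      obtain ⟨C, hC⟩ := banach_steinhaus (g := g) fun z => by
        obtain ⟨C, hC⟩ := ih (Function.update x i z)
        refine ⟨C, fun y => ?_⟩
        rw [hg]
        refine hC _ (fun j hj => ?_) fun j hj => ?_
        · rw [Function.update_of_ne (ne_of_mem_of_not_mem hj his)]
          exact y.2.1 j hj
        · rcases eq_or_ne j i with rfl | hji
          · simp
          · rw [Function.update_of_ne hji, Function.update_of_ne hji]
            exact y.2.2 j (by simp [hji, hj])
      refine ⟨C, fun y hy hyx => ?_⟩
      let y' : I := ⟨y, fun j hj => hy j (Finset.mem_insert_of_mem hj), hyx⟩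
      have h := hg y' (y i)
      rw [Function.update_eq_self] at h
      rw [← h]
      calc ‖g y' (y i)‖ ≤ ‖g y'‖ * ‖y i‖ := (g y').le_opNorm _
        _ ≤ ‖g y'‖ * 1 :=
          mul_le_mul_of_nonneg_left (hy i (Finset.mem_insert_self i s)) (norm_nonneg _)
        _ ≤ C := by simpa using hC y'
  obtain ⟨C, hC⟩ := key Finset.univ 0
  exact ⟨C, M.norm_le_mul_prod_of_norm_le_on_unit_ball fun x hx =>
    hC x (fun i _ => hx i) (by simp)⟩

end SeparateContinuity

section Multipolynomial

variable {𝕜 : Type*} [RCLike 𝕜] {m : ℕ} {n : Fin m → ℕ}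
  {E : Fin m → Type*} [∀ i, NormedAddCommGroup (E i)] [∀ i, NormedSpace 𝕜 (E i)]
  {F : Type*} [NormedAddCommGroup F] [NormedSpace 𝕜 F]

theorem IsMultipolynomial.map_smul {P : (∀ i, E i) → F} (hP : IsMultipolynomial 𝕜 n P)
    (c : Fin m → 𝕜) (x : ∀ i, E i) :
    P (fun i => c i • x i) = (∏ i, c i ^ n i) • P x := by
  have key (s : Finset (Fin m)) : P (s.piecewise (fun i => c i • x i) x) =
      (∏ i ∈ s, c i ^ n i) • P x := by
    induction s using Finset.induction_on with
    | empty => simp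
    | insert i s his ih =>
      obtain ⟨A, hA⟩ := hP i (s.piecewise (fun i => c i • x i) x)
      have hself : Function.update (s.piecewise (fun i => c i • x i) x) i (x i) =
          s.piecewise (fun i => c i • x i) x := by
        rw [Function.update_eq_self_iff, Finset.piecewise_eq_of_notMem _ _ _ his]
      have hx := hA (x i)
      rw [hself, ih] at hx
      rw [Finset.piecewise_insert, hA, A.map_smul_univ (fun _ => c i) fun _ => x i, ← hx,
        Finset.prod_insert his, smul_smul]
      simp
  simpa using key Finset.univ

theorem ContinuousMultilinearMap.isMultipolynomial_diagonal
    (T : ContinuousMultilinearMap 𝕜 (fun p : Σ i : Fin m, Fin (n i) => E p.1) F) :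
    IsMultipolynomial 𝕜 n fun x => T fun p => x p.1 := by
  intro i x
  let e (w : Fin (n i) → E i) (p : Σ i : Fin m, Fin (n i)) : E p.1 :=
    Function.update (β := fun j => Fin (n j) → E j) (fun j _ => x j) i w p.1 p.2
  have he (w : Fin (n i) → E i) (k : Fin (n i)) (v : E i) :
      e (Function.update w k v) = Function.update (e w) ⟨i, k⟩ v := by
    funext ⟨j, l⟩
    rcases eq_or_ne j i with rfl | hj
    · rcases eq_or_ne l k with rfl | hl
      · simp [e]
      · simp [e, hl]
    · simp [e, hj]
  refine ⟨⟨MultilinearMap.mk' (fun w => T (e w)) ?_ ?_, ?_⟩, fun y => ?_⟩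
  · intro w k u v
    simp only [he, T.map_update_add]
  · intro w k c v
    simp only [he, T.map_update_smul]
  · have hupd : Continuous fun w : Fin (n i) → E i =>
        Function.update (β := fun j => Fin (n j) → E j) (fun j _ => x j) i w :=
      continuous_const.update i continuous_id
    exact T.cont.comp (continuous_pi fun p =>
      continuous_pi_iff.1 (continuous_pi_iff.1 hupd p.1) p.2)
  · change T _ = T _
    congr 1
    funext ⟨j, l⟩
    rcases eq_or_ne j i with rfl | hj
    · simp [e]
    · simp [e, hj]

theorem exists_continuousMultilinearMap_sum_signs {V : Type*} [NormedAddCommGroup V]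
    [NormedSpace 𝕜 V] {κ : Type*} [Fintype κ] [DecidableEq κ]
    (A : ContinuousMultilinearMap 𝕜 (fun _ : κ => V) F) :
    ∃ B : ContinuousMultilinearMap 𝕜 (fun _ : κ => V) F, ∀ z : κ → V,
      ∑ δ : κ → ℤˣ, (((∏ k, δ k : ℤˣ) : ℤ) : 𝕜) • A (fun _ => ∑ k, ((δ k : ℤ) : 𝕜) • z k) =
        B z := by
  refine ⟨(Fintype.card (κ → ℤˣ) : 𝕜) • ∑ σ : Equiv.Perm κ, A.domDomCongr σ, fun z => ?_⟩
  have h := signedSum_diagonal (𝕜 := 𝕜) (ι := Unit) (κ := fun _ => κ) (E := fun _ => V) (F := F)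
    (A.toMultilinearMap.domDomCongr (Equiv.uniqueSigma fun _ : Unit => κ).symm) fun p => z p.2
  have hcard : Fintype.card (Unit → κ → ℤˣ) = Fintype.card (κ → ℤˣ) :=
    Fintype.card_congr (Equiv.funUnique Unit _)
  rw [hcard] at h
  refine Eq.trans ?_ (h.trans ?_)
  · refine (Fintype.sum_equiv (Equiv.funUnique Unit (κ → ℤˣ)) _ _ fun ε => ?_).symm
    rw [Fintype.prod_unique]
    rfl
  · rw [smul_apply, sum_apply]
    congr 1
    exact Fintype.sum_equiv (Equiv.funUnique Unit (Equiv.Perm κ)) _ _ fun σ => rfl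

theorem IsMultipolynomial.exists_signedSum_eq {P : (∀ i, E i) → F}
    (hP : IsMultipolynomial 𝕜 n P) (i : Fin m) (x : ∀ p : Σ i : Fin m, Fin (n i), E p.1) :
    ∃ B : ContinuousMultilinearMap 𝕜 (fun _ : Fin (n i) => E i) F,
      ∀ x' : ∀ p : Σ i : Fin m, Fin (n i), E p.1, (∀ p, p.1 ≠ i → x' p = x p) →
        signedSum 𝕜 P x' = B fun k => x' ⟨i, k⟩ := by
  choose A hA using fun ε : ∀ i, Fin (n i) → ℤˣ =>
    hP i (fun j => ∑ k, ((ε j k : ℤ) : 𝕜) • x ⟨j, k⟩)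
  choose B hB using fun ε => exists_continuousMultilinearMap_sum_signs (A ε)
  let scale (ε : ∀ i, Fin (n i) → ℤˣ) (k : Fin (n i)) : E i →L[𝕜] E i :=
    ((ε i k : ℤ) : 𝕜) • ContinuousLinearMap.id 𝕜 (E i)
  refine ⟨(Fintype.card (Fin (n i) → ℤˣ) : 𝕜)⁻¹ • ∑ ε : ∀ i, Fin (n i) → ℤˣ,
    (((∏ i, ∏ k, ε i k : ℤˣ) : ℤ) : 𝕜) • (B ε).compContinuousLinearMap (scale ε),
    fun x' hx' => ?_⟩
  have hcard : (Fintype.card (Fin (n i) → ℤˣ) : 𝕜) ≠ 0 := by simp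
  rw [← inv_smul_smul₀ hcard (signedSum 𝕜 P x'), card_signs_smul_signedSum P x' i]
  simp only [smul_apply, sum_apply]
  congr 1
  refine Finset.sum_congr rfl fun ε _ => ?_
  congr 1
  have hupd (v : E i) : Function.update (fun j => ∑ k, ((ε j k : ℤ) : 𝕜) • x' ⟨j, k⟩) i v =
      Function.update (fun j => ∑ k, ((ε j k : ℤ) : 𝕜) • x ⟨j, k⟩) i v := by
    funext j
    rcases eq_or_ne j i with rfl | hj
    · simp
    · simp only [Function.update_of_ne hj, hx' ⟨j, _⟩ hj]
  simp only [hupd, hA, hB]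
  rfl

theorem IsMultipolynomial.exists_signedSum_update {P : (∀ i, E i) → F}
    (hP : IsMultipolynomial 𝕜 n P) (x : ∀ p : Σ i : Fin m, Fin (n i), E p.1)
    (q : Σ i : Fin m, Fin (n i)) :
    ∃ ℓ : E q.1 →L[𝕜] F, ∀ y, signedSum 𝕜 P (Function.update x q y) = ℓ y := by
  obtain ⟨i, k⟩ := q
  obtain ⟨B, hB⟩ := hP.exists_signedSum_eq i x
  refine ⟨B.toContinuousLinearMap (fun l => x ⟨i, l⟩) k, fun y => ?_⟩
  rw [hB _ fun p hp => Function.update_of_ne (fun h => hp (congrArg Sigma.fst h)) _ _]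
  change B _ = B _
  congr 1
  funext l
  rcases eq_or_ne l k with rfl | hl
  · simp
  · simp [hl]

/-- The signed sum of a multipolynomial, as a multilinear map. -/
def IsMultipolynomial.signedSumMultilinear {P : (∀ i, E i) → F} (hP : IsMultipolynomial 𝕜 n P) :
    MultilinearMap 𝕜 (fun p : Σ i : Fin m, Fin (n i) => E p.1) F :=
  MultilinearMap.mk' (signedSum 𝕜 P)
    (fun x q u v => by
      obtain ⟨ℓ, hℓ⟩ := hP.exists_signedSum_update x q
      simp only [hℓ, map_add])
    (fun x q c v => by
      obtain ⟨ℓ, hℓ⟩ := hP.exists_signedSum_update x q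
      simp only [hℓ, ContinuousLinearMap.map_smul])

theorem IsMultipolynomial.exists_blockSymmetric [∀ i, CompleteSpace (E i)] {P : (∀ i, E i) → F}
    (hP : IsMultipolynomial 𝕜 n P) :
    ∃ T : ContinuousMultilinearMap 𝕜 (fun p : Σ i : Fin m, Fin (n i) => E p.1) F,
      BlockSymmetric T ∧ ∀ x, P x = T fun p => x p.1 := by
  let M := hP.signedSumMultilinear
  obtain ⟨C, hC⟩ := M.exists_bound_of_separately_continuous fun x q => by
    obtain ⟨ℓ, hℓ⟩ := hP.exists_signedSum_update x q
    exact ℓ.continuous.congr fun y => (hℓ y).symm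
  set a : 𝕜 := (Fintype.card (∀ i, Fin (n i) → ℤˣ) : 𝕜) *
    ∏ i, ((Fintype.card (Fin (n i))).factorial : 𝕜) with ha
  have ha0 : a ≠ 0 := mul_ne_zero (Nat.cast_ne_zero.2 Fintype.card_ne_zero)
    (Finset.prod_ne_zero_iff.2 fun i _ => Nat.cast_ne_zero.2 (Nat.factorial_ne_zero _))
  refine ⟨a⁻¹ • M.mkContinuous C hC, fun σ x => ?_, fun x => ?_⟩
  · exact congrArg (a⁻¹ • ·) (signedSum_comp_perm P σ x)
  · change P x = a⁻¹ • signedSum 𝕜 P (fun p => x p.1)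
    rw [signedSum_diagonal_of_homogeneous (by simpa using hP.map_smul), inv_smul_smul₀ ha0]

theorem BlockSymmetric.signedSum_diagonal
    {T : ContinuousMultilinearMap 𝕜 (fun p : Σ i : Fin m, Fin (n i) => E p.1) F}
    (hT : BlockSymmetric T) (x : ∀ p : Σ i : Fin m, Fin (n i), E p.1) :
    signedSum 𝕜 (fun y => T fun p => y p.1) x =
      ((Fintype.card (∀ i, Fin (n i) → ℤˣ) : 𝕜) * (∏ i, (n i).factorial : ℕ)) • T x := by
  refine (_root_.signedSum_diagonal (𝕜 := 𝕜) (E := E) (F := F) T.toMultilinearMap x).trans ?_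
  have (σ : ∀ i, Equiv.Perm (Fin (n i))) :
      T.toMultilinearMap (fun p => x ⟨p.1, σ p.1 p.2⟩) = T x := hT σ x
  simp [this, mul_smul, Fintype.card_pi, Fintype.card_perm, ← Nat.cast_smul_eq_nsmul 𝕜]

theorem BlockSymmetric.ext_diagonal
    {T S : ContinuousMultilinearMap 𝕜 (fun p : Σ i : Fin m, Fin (n i) => E p.1) F}
    (hT : BlockSymmetric T) (hS : BlockSymmetric S)
    (h : ∀ x : ∀ i, E i, T (fun p => x p.1) = S fun p => x p.1) : T = S := by
  ext x
  have hx := hT.signedSum_diagonal x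
  rw [funext h, hS.signedSum_diagonal x] at hx
  refine (smul_right_injective F (mul_ne_zero (Nat.cast_ne_zero.2 Fintype.card_ne_zero)
    (Nat.cast_ne_zero.2 ?_)) hx).symm
  exact Finset.prod_ne_zero_iff.2 fun i _ => Nat.factorial_ne_zero _

theorem norm_diagonal_le_opNorm
    (T : ContinuousMultilinearMap 𝕜 (fun p : Σ i : Fin m, Fin (n i) => E p.1) F)
    {x : ∀ i, E i} (hx : ∀ i, ‖x i‖ ≤ 1) : ‖T fun p => x p.1‖ ≤ ‖T‖ :=
  (T.le_opNorm _).trans (mul_le_of_le_one_right (norm_nonneg _)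
    (Finset.prod_le_one (fun _ _ => norm_nonneg _) fun p _ => hx p.1))

theorem polyNorm_diagonal_le
    (T : ContinuousMultilinearMap 𝕜 (fun p : Σ i : Fin m, Fin (n i) => E p.1) F) :
    polyNorm (fun x : ∀ i, E i => T fun p => x p.1) ≤ ‖T‖ := by
  refine csSup_le ⟨_, 0, by simp, rfl⟩ ?_
  rintro _ ⟨x, hx, rfl⟩
  exact norm_diagonal_le_opNorm T hx

theorem norm_diagonal_le_polyNorm
    (T : ContinuousMultilinearMap 𝕜 (fun p : Σ i : Fin m, Fin (n i) => E p.1) F)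
    {x : ∀ i, E i} (hx : ∀ i, ‖x i‖ ≤ 1) :
    ‖T fun p => x p.1‖ ≤ polyNorm fun x : ∀ i, E i => T fun p => x p.1 := by
  refine le_csSup ⟨‖T‖, ?_⟩ ⟨x, hx, rfl⟩
  rintro _ ⟨y, hy, rfl⟩
  exact norm_diagonal_le_opNorm T hy

theorem BlockSymmetric.opNorm_le
    {T : ContinuousMultilinearMap 𝕜 (fun p : Σ i : Fin m, Fin (n i) => E p.1) F}
    (hT : BlockSymmetric T) (hn : ∀ i, 0 < n i) :
    ‖T‖ ≤ ((∏ i, (n i) ^ (n i) : ℕ) : ℝ) / ((∏ i, Nat.factorial (n i) : ℕ) : ℝ) *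
      polyNorm fun x : ∀ i, E i => T fun p => x p.1 := by
  set N := polyNorm fun x : ∀ i, E i => T fun p => x p.1
  have hN : 0 ≤ N := (norm_nonneg _).trans (norm_diagonal_le_polyNorm T (x := 0) (by simp))
  have hscale (y : ∀ i, E i) (hy : ∀ i, ‖y i‖ ≤ n i) :
      ‖T fun p => y p.1‖ ≤ ((∏ i, (n i) ^ (n i) : ℕ) : ℝ) * N := by
    have hn0 (i : Fin m) : (n i : 𝕜) ≠ 0 := Nat.cast_ne_zero.2 (hn i).ne'
    have h := T.isMultipolynomial_diagonal.map_smul (fun i => (n i : 𝕜))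
      fun i => (n i : 𝕜)⁻¹ • y i
    simp only [smul_inv_smul₀ (hn0 _)] at h
    rw [h, norm_smul, norm_prod]
    simp only [norm_pow, RCLike.norm_natCast, Nat.cast_prod, Nat.cast_pow]
    refine mul_le_mul_of_nonneg_left
      (norm_diagonal_le_polyNorm T (x := fun i => (n i : 𝕜)⁻¹ • y i) fun i => ?_) (by positivity)
    rw [norm_smul, norm_inv, RCLike.norm_natCast]
    exact inv_mul_le_one_of_le₀ (hy i) (Nat.cast_nonneg _)
  refine T.opNorm_le_bound (by positivity)
    (T.toMultilinearMap.norm_le_mul_prod_of_norm_le_on_unit_ball fun x hx => ?_)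
  change ‖T x‖ ≤ _
  set K := Fintype.card (∀ i, Fin (n i) → ℤˣ) with hK
  have hK0 : (0 : ℝ) < K := Nat.cast_pos.2 Fintype.card_pos
  have hfac : (0 : ℝ) < (∏ i, (n i).factorial : ℕ) :=
    Nat.cast_pos.2 (Finset.prod_pos fun i _ => Nat.factorial_pos _)
  have hsign (u : ℤˣ) : ‖((u : ℤ) : 𝕜)‖ = 1 := by
    rcases Int.units_eq_one_or u with rfl | rfl <;> simp
  have hsum : ‖signedSum 𝕜 (fun y => T fun p => y p.1) x‖ ≤
      K * (((∏ i, (n i) ^ (n i) : ℕ) : ℝ) * N) := by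
    rw [hK, ← nsmul_eq_mul]
    refine norm_sum_le_of_le _ (fun ε _ => ?_) |>.trans_eq (by
      rw [Finset.sum_const, Finset.card_univ])
    rw [norm_smul, hsign, one_mul]
    refine hscale (fun i => ∑ k, ((ε i k : ℤ) : 𝕜) • x ⟨i, k⟩) fun i => ?_
    have hterm (k : Fin (n i)) : ‖((ε i k : ℤ) : 𝕜) • x ⟨i, k⟩‖ ≤ 1 := by
      rw [norm_smul, hsign, one_mul]
      exact hx ⟨i, k⟩
    exact (norm_sum_le_of_le _ fun k _ => hterm k).trans_eq (by simp)
  rw [hT.signedSum_diagonal, norm_smul, norm_mul, RCLike.norm_natCast, RCLike.norm_natCast,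
    mul_assoc] at hsum
  rw [div_mul_eq_mul_div, le_div_iff₀' hfac]
  exact le_of_mul_le_mul_left hsum hK0

end Multipolynomial

/-- The map `Φ(T) = T̂`, sending a continuous `(n₁,…,nₘ)`-symmetric
`(n₁ + ⋯ + nₘ)`-linear map `T : E₁^{n₁} × ⋯ × Eₘ^{nₘ} → F` to its block diagonal
`T̂(x₁,…,xₘ) = T(x₁,…,x₁,…,xₘ,…,xₘ)`, is a linear bijection onto the space of continuous
`(n₁,…,nₘ)`-homogeneous polynomials `E₁ × ⋯ × Eₘ → F`, and
`‖T̂‖ ≤ ‖T‖ ≤ (n₁^{n₁} ⋯ nₘ^{nₘ} / (n₁! ⋯ nₘ!)) ‖T̂‖`; in particular `Φ` is an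
isomorphism of Banach spaces. -/
theorem diagonal_isomorphism
    {𝕜 : Type*} [RCLike 𝕜] {m : ℕ} (n : Fin m → ℕ) (hn : ∀ i, 0 < n i)
    {E : Fin m → Type*} [∀ i, NormedAddCommGroup (E i)] [∀ i, NormedSpace 𝕜 (E i)]
    [∀ i, CompleteSpace (E i)]
    {F : Type*} [NormedAddCommGroup F] [NormedSpace 𝕜 F] [CompleteSpace F] :
    -- Φ maps into the space of continuous multipolynomials
    (∀ T : ContinuousMultilinearMap 𝕜 (fun p : Σ i : Fin m, Fin (n i) => E p.1) F,
      BlockSymmetric T →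
        IsMultipolynomial 𝕜 n (fun x : (i : Fin m) → E i => T (fun p => x p.1))) ∧
    -- Φ is linear
    (∀ (a : 𝕜) (T S : ContinuousMultilinearMap 𝕜 (fun p : Σ i : Fin m, Fin (n i) => E p.1) F)
      (x : (i : Fin m) → E i),
      (a • T + S) (fun p => x p.1) = a • T (fun p => x p.1) + S (fun p => x p.1)) ∧
    -- Φ is injective on (n₁,…,nₘ)-symmetric maps
    (∀ T S : ContinuousMultilinearMap 𝕜 (fun p : Σ i : Fin m, Fin (n i) => E p.1) F,
      BlockSymmetric T → BlockSymmetric S →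
      (∀ x : (i : Fin m) → E i, T (fun p => x p.1) = S (fun p => x p.1)) → T = S) ∧
    -- Φ is surjective onto the space of continuous multipolynomials
    (∀ P : ((i : Fin m) → E i) → F, IsMultipolynomial 𝕜 n P →
      ∃ T : ContinuousMultilinearMap 𝕜 (fun p : Σ i : Fin m, Fin (n i) => E p.1) F,
        BlockSymmetric T ∧ ∀ x : (i : Fin m) → E i, P x = T (fun p => x p.1)) ∧
    -- the norm estimates ‖T̂‖ ≤ ‖T‖ ≤ (n₁^{n₁}⋯nₘ^{nₘ}/(n₁!⋯nₘ!)) ‖T̂‖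
    (∀ T : ContinuousMultilinearMap 𝕜 (fun p : Σ i : Fin m, Fin (n i) => E p.1) F,
      BlockSymmetric T →
        polyNorm (fun x : (i : Fin m) → E i => T (fun p => x p.1)) ≤ ‖T‖ ∧
        ‖T‖ ≤ ((∏ i, (n i) ^ (n i) : ℕ) : ℝ) / ((∏ i, Nat.factorial (n i) : ℕ) : ℝ) *
          polyNorm (fun x : (i : Fin m) → E i => T (fun p => x p.1))) := by
  exact ⟨fun T _ => T.isMultipolynomial_diagonal, fun _ _ _ _ => rfl,
    fun _ _ hT hS => hT.ext_diagonal hS, fun _ hP => hP.exists_blockSymmetric,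
    fun T hT => ⟨polyNorm_diagonal_le T, hT.opNorm_le hn⟩⟩
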